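/- arXiv:1203.0223 — 9 statements merged into one kernel-verified Lean document; each statement's English description precedes it below -/
import Mathlib

section
/- Let L be a reduced Latin square of order n with rows σ_1,…,σ_n and columns π_1,…,π_n (viewed as permutations). For every α ∈ S_n and every j ∈ [n], the isotopism (α, α∘π_j∘σ_{α⁻¹(1)}⁻¹, α∘π_j) maps L to a reduced Latin square; conversely, every isotopism Θ such that Θ(L) is a reduced Latin square is of this form for some α ∈ S_n and j ∈ [n]. -/
open Equiv Finset

/-- A Latin square of order `n`: an `n × n` array of symbols from `Fin n`
such that every symbol occurs exactly once in each row and each column. -/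
structure LatinSquare (n : ℕ) where
  entry : Fin n → Fin n → Fin n
  row_bij : ∀ r : Fin n, Function.Bijective fun c => entry r c
  col_bij : ∀ c : Fin n, Function.Bijective fun r => entry r c

namespace LatinSquare

variable {n : ℕ}

/-- Row `r` of `L` as a permutation: `rowPerm L r i = j ↔ L r j = i`. -/
noncomputable def rowPerm (L : LatinSquare n) (r : Fin n) : Equiv.Perm (Fin n) :=
  (Equiv.ofBijective _ (L.row_bij r)).symm

/-- Column `c` of `L` as a permutation: `colPerm L c i = j ↔ L j c = i`. -/
noncomputable def colPerm (L : LatinSquare n) (c : Fin n) : Equiv.Perm (Fin n) :=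
  (Equiv.ofBijective _ (L.col_bij c)).symm

/-- The isotopism `(α, β, γ)` applied to `L`: `α` permutes rows, `β` permutes
columns, `γ` permutes symbols. -/
def isotope (α β γ : Equiv.Perm (Fin n)) (L : LatinSquare n) : LatinSquare n where
  entry r c := γ (L.entry (α⁻¹ r) (β⁻¹ c))
  row_bij r := by
    have h : (fun c => γ (L.entry (α⁻¹ r) (β⁻¹ c))) =
        (γ : Fin n → Fin n) ∘ (fun c => L.entry (α⁻¹ r) c) ∘ (β⁻¹ : Equiv.Perm (Fin n)) := rfl
    rw [h]
    exact (γ.bijective.comp (L.row_bij _)).comp (β⁻¹).bijective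
  col_bij c := by
    have h : (fun r => γ (L.entry (α⁻¹ r) (β⁻¹ c))) =
        (γ : Fin n → Fin n) ∘ (fun r => L.entry r (β⁻¹ c)) ∘ (α⁻¹ : Equiv.Perm (Fin n)) := rfl
    rw [h]
    exact (γ.bijective.comp (L.col_bij _)).comp (α⁻¹).bijective

/-- `L'` is isotopic to `L` if some isotopism transforms `L` into `L'`. -/
def Isotopic (L L' : LatinSquare n) : Prop :=
  ∃ α β γ : Equiv.Perm (Fin n), isotope α β γ L = L'

/-- A Latin square is reduced if its first row and first column are the identity. -/
def Reduced [NeZero n] (L : LatinSquare n) : Prop :=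
  L.rowPerm 0 = 1 ∧ L.colPerm 0 = 1

/-- The parity of `L`: the product of the signs of all rows and all columns. -/
noncomputable def par (L : LatinSquare n) : ℤˣ :=
  (∏ r : Fin n, Equiv.Perm.sign (L.rowPerm r)) * ∏ c : Fin n, Equiv.Perm.sign (L.colPerm c)

/-- The parity type `(k, m)` of `L`: `k` is the minimum of the number of even rows
and the number of odd rows, `m` is the analogous quantity for columns. -/
noncomputable def parityType (L : LatinSquare n) : ℕ × ℕ :=
  (min (univ.filter fun r => Equiv.Perm.sign (L.rowPerm r) = 1).card
      (univ.filter fun r => Equiv.Perm.sign (L.rowPerm r) = -1).card,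
   min (univ.filter fun c => Equiv.Perm.sign (L.colPerm c) = 1).card
      (univ.filter fun c => Equiv.Perm.sign (L.colPerm c) = -1).card)

end LatinSquare

/-- The number of autotopisms of `L`, i.e. the order of the autotopy group `𝔄(L)`. -/
noncomputable def autotopyCard {n : ℕ} (L : LatinSquare n) : ℕ :=
  Nat.card {Θ : Equiv.Perm (Fin n) × Equiv.Perm (Fin n) × Equiv.Perm (Fin n) //
    LatinSquare.isotope Θ.1 Θ.2.1 Θ.2.2 L = L}

theorem LatinSquare.reduced_isotope_iff {n : ℕ} [NeZero n] (L : LatinSquare n)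
    (α β γ : Equiv.Perm (Fin n)) :
    (LatinSquare.isotope α β γ L).Reduced ↔
      β = γ * (L.rowPerm (α⁻¹ 0))⁻¹ ∧ γ = α * L.colPerm (β⁻¹ 0) := by
  have h1 : (LatinSquare.isotope α β γ L).rowPerm 0
      = (γ * (L.rowPerm (α⁻¹ 0))⁻¹ * β⁻¹)⁻¹ := by
    rw [eq_inv_iff_mul_eq_one, mul_eq_one_iff_inv_eq]
    ext x
    rfl
  have h2 : (LatinSquare.isotope α β γ L).colPerm 0
      = (γ * (L.colPerm (β⁻¹ 0))⁻¹ * α⁻¹)⁻¹ := by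
    rw [eq_inv_iff_mul_eq_one, mul_eq_one_iff_inv_eq]
    ext x
    rfl
  unfold LatinSquare.Reduced
  rw [h1, h2, inv_eq_one, inv_eq_one, mul_inv_eq_one, mul_inv_eq_one]
  constructor
  · rintro ⟨a, b⟩
    exact ⟨a.symm, mul_inv_eq_iff_eq_mul.1 b⟩
  · rintro ⟨a, b⟩
    exact ⟨a.symm, mul_inv_eq_iff_eq_mul.2 b⟩

/-- for a reduced Latin square `L`, the isotopisms
`(α, α∘π_j∘σ_{α⁻¹(1)}⁻¹, α∘π_j)` are exactly the isotopisms mapping `L` to a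
reduced Latin square. -/
theorem stmt2 {n : ℕ} [NeZero n] (L : LatinSquare n) (hL : L.Reduced) :
    (∀ (α : Equiv.Perm (Fin n)) (j : Fin n),
      (LatinSquare.isotope α (α * L.colPerm j * (L.rowPerm (α⁻¹ 0))⁻¹) (α * L.colPerm j)
        L).Reduced) ∧
    (∀ α β γ : Equiv.Perm (Fin n), (LatinSquare.isotope α β γ L).Reduced →
      ∃ j : Fin n, β = α * L.colPerm j * (L.rowPerm (α⁻¹ 0))⁻¹ ∧ γ = α * L.colPerm j) := by
  refine ⟨fun α j => ?_, fun α β γ h => ?_⟩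
  · rw [LatinSquare.reduced_isotope_iff]
    refine ⟨rfl, ?_⟩
    have h : (α * L.colPerm j * (L.rowPerm (α⁻¹ 0))⁻¹)⁻¹ 0 = j := by
      rw [Equiv.Perm.inv_eq_iff_eq]
      have h3 : L.colPerm j (L.entry (α⁻¹ 0) j) = α⁻¹ 0 :=
        (Equiv.ofBijective _ (L.col_bij j)).symm_apply_apply (α⁻¹ 0)
      have h4 : (L.rowPerm (α⁻¹ 0))⁻¹ j = L.entry (α⁻¹ 0) j := rfl
      rw [Equiv.Perm.mul_apply, Equiv.Perm.mul_apply, h4, h3]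
      simp
    rw [h]
  · rw [LatinSquare.reduced_isotope_iff] at h
    obtain ⟨h1, h2⟩ := h
    refine ⟨β⁻¹ 0, ?_, h2⟩
    rw [← h2]
    exact h1
end

section
/- For every Latin square L of order n, |𝓘′_n(L)| · |𝔄(L)| = n·n!, where 𝓘′_n(L) is the set of reduced Latin squares isotopic to L and 𝔄(L) is the autotopy group of L. -/
open Equiv Finset

namespace LatinSquare

theorem ext_entry {n : ℕ} {L M : LatinSquare n} (h : ∀ r c, L.entry r c = M.entry r c) : L = M := by
  cases L; cases M
  congr
  funext r c
  exact h r c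

theorem reduced_iff {n : ℕ} [NeZero n] (L : LatinSquare n) :
    L.Reduced ↔ (∀ c, L.entry 0 c = c) ∧ (∀ r, L.entry r 0 = r) := by
  unfold Reduced rowPerm colPerm
  refine and_congr ?_ ?_
  · rw [← Equiv.Perm.inv_def, inv_eq_one, Equiv.ext_iff]
    rfl
  · rw [← Equiv.Perm.inv_def, inv_eq_one, Equiv.ext_iff]
    rfl

theorem isotope_mul {n : ℕ} (a b c a' b' c' : Equiv.Perm (Fin n)) (L : LatinSquare n) :
    isotope (a * a') (b * b') (c * c') L = isotope a b c (isotope a' b' c' L) := by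
  apply ext_entry
  intro r s
  simp [isotope, mul_inv_rev]

theorem isotope_one {n : ℕ} (L : LatinSquare n) : isotope 1 1 1 L = L := by
  apply ext_entry
  intro r s
  simp [isotope]

theorem isotope_inv_of_eq {n : ℕ} {a b c : Equiv.Perm (Fin n)} {L M : LatinSquare n}
    (h : isotope a b c L = M) : isotope a⁻¹ b⁻¹ c⁻¹ M = L := by
  rw [← h, ← isotope_mul]
  simp [isotope_one]

theorem card_T_left {n : ℕ} [NeZero n] (L : LatinSquare n) :
    Nat.card {L' : LatinSquare n // L'.Reduced ∧ LatinSquare.Isotopic L L'} * autotopyCard L =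
    Nat.card {Θ : Equiv.Perm (Fin n) × Equiv.Perm (Fin n) × Equiv.Perm (Fin n) //
      (isotope Θ.1 Θ.2.1 Θ.2.2 L).Reduced} := by
  unfold autotopyCard
  rw [← Nat.card_prod]
  have hc : ∀ M : {L' : LatinSquare n // L'.Reduced ∧ LatinSquare.Isotopic L L'},
      ∃ Θ : Equiv.Perm (Fin n) × Equiv.Perm (Fin n) × Equiv.Perm (Fin n),
        isotope Θ.1 Θ.2.1 Θ.2.2 L = M.1 := by
    rintro ⟨M, _, a, b, c, h⟩
    exact ⟨(a, b, c), h⟩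
  choose t ht using hc
  have key : ∀ (M : {L' : LatinSquare n // L'.Reduced ∧ LatinSquare.Isotopic L L'})
      (A : {Θ : Equiv.Perm (Fin n) × Equiv.Perm (Fin n) × Equiv.Perm (Fin n) //
        isotope Θ.1 Θ.2.1 Θ.2.2 L = L}),
      isotope (t M * A.1).1 (t M * A.1).2.1 (t M * A.1).2.2 L = M.1 := by
    intro M A
    simp only [Prod.fst_mul, Prod.snd_mul]
    rw [isotope_mul, A.2, ht]
  refine Nat.card_congr (Equiv.ofBijective
    (fun p => ⟨t p.1 * p.2.1, by rw [key]; exact p.1.2.1⟩) ⟨?_, ?_⟩)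
  · rintro ⟨M, A⟩ ⟨M', A'⟩ h
    have h' : t M * A.1 = t M' * A'.1 := congrArg Subtype.val h
    have hM : M = M' := by
      apply Subtype.ext
      rw [← key M A, ← key M' A', h']
    subst hM
    have : A = A' := Subtype.ext (mul_left_cancel h')
    rw [this]
  · rintro ⟨Θ, hΘ⟩
    let M : {L' : LatinSquare n // L'.Reduced ∧ LatinSquare.Isotopic L L'} :=
      ⟨isotope Θ.1 Θ.2.1 Θ.2.2 L, hΘ, _, _, _, rfl⟩
    refine ⟨⟨M, ⟨(t M)⁻¹ * Θ, ?_⟩⟩, ?_⟩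
    · simp only [Prod.fst_mul, Prod.snd_mul, Prod.fst_inv, Prod.snd_inv]
      rw [isotope_mul]
      exact isotope_inv_of_eq (ht M)
    · apply Subtype.ext
      simp

theorem card_T_right {n : ℕ} [NeZero n] (L : LatinSquare n) :
    Nat.card {Θ : Equiv.Perm (Fin n) × Equiv.Perm (Fin n) × Equiv.Perm (Fin n) //
      (isotope Θ.1 Θ.2.1 Θ.2.2 L).Reduced} = n * n.factorial := by
  have hcard : Nat.card (Fin n × Equiv.Perm (Fin n)) = n * n.factorial := by
    simp [Nat.card_eq_fintype_card, Fintype.card_perm]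
  rw [← hcard]
  refine Nat.card_congr (Equiv.ofBijective (fun Θ => (Θ.1.2.1⁻¹ 0, Θ.1.1)) ⟨?_, ?_⟩)
  · rintro ⟨⟨a, b, c⟩, h⟩ ⟨⟨a', b', c'⟩, h'⟩ e
    rw [reduced_iff] at h h'
    simp only [isotope, Prod.mk.injEq] at h h' e
    obtain ⟨e1, rfl⟩ := e
    have hcc : c = c' := by
      ext1 s
      obtain ⟨r, rfl⟩ := (L.col_bij (b⁻¹ 0)).2 s
      have h1 := h.2 (a r)
      have h2 := h'.2 (a r)
      rw [← e1] at h2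
      rw [show a⁻¹ (a r) = r from a.symm_apply_apply r] at h1 h2
      exact h1.trans h2.symm
    subst hcc
    have hbb : b = b' := by
      ext1 s
      have h1 := h.1 (b s)
      have h2 := h'.1 (b' s)
      rw [show b⁻¹ (b s) = s from b.symm_apply_apply s] at h1
      rw [show b'⁻¹ (b' s) = s from b'.symm_apply_apply s] at h2
      exact h1.symm.trans h2
    subst hbb
    rfl
  · rintro ⟨j, a⟩
    let C : Equiv.Perm (Fin n) := Equiv.ofBijective _ (L.col_bij j)
    let R : Equiv.Perm (Fin n) := Equiv.ofBijective _ (L.row_bij (a⁻¹ 0))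
    have hC : ∀ r, C r = L.entry r j := fun _ => rfl
    have hR : ∀ s, R s = L.entry (a⁻¹ 0) s := fun _ => rfl
    have hj : (a * C⁻¹ * R)⁻¹ 0 = j := by
      rw [Equiv.Perm.inv_eq_iff_eq]
      simp only [Equiv.Perm.mul_apply]
      rw [hR, ← hC]
      simp
    refine ⟨⟨(a, a * C⁻¹ * R, a * C⁻¹), ?_⟩, ?_⟩
    · rw [reduced_iff]
      simp only [isotope]
      constructor
      · intro s
        rw [← hR]
        simp [mul_inv_rev]
      · intro r
        rw [hj, ← hC]
        simp
    · exact Prod.ext hj rfl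

end LatinSquare

/-- for every Latin square `L` of order `n`,
`|𝓘′_n(L)| ⬝ |𝔄(L)| = n ⬝ n!`, where `𝓘′_n(L)` is the set of reduced Latin squares
isotopic to `L` and `𝔄(L)` is the autotopy group of `L`. -/
theorem stmt3 {n : ℕ} [NeZero n] (L : LatinSquare n) :
    Nat.card {L' : LatinSquare n // L'.Reduced ∧ LatinSquare.Isotopic L L'} *
      autotopyCard L = n * n.factorial := by
  rw [LatinSquare.card_T_left, LatinSquare.card_T_right]
end

section
/- Let n be odd, let L be a reduced Latin square of order n with rows σ_1,…,σ_n and columns π_1,…,π_n (as permutations), and let Θ = (α, α∘π_j∘σ_{α⁻¹(1)}⁻¹, α∘π_j) for some α ∈ S_n and j ∈ [n]. Then par(Θ(L)) = sgn(σ_{α⁻¹(1)}) · sgn(π_j) · par(L). -/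
open Equiv Finset

theorem isotope_rowPerm {n : ℕ} (α β γ : Equiv.Perm (Fin n)) (L : LatinSquare n) (r : Fin n) :
    (LatinSquare.isotope α β γ L).rowPerm r = β * L.rowPerm (α⁻¹ r) * γ⁻¹ := by
  rw [← inv_inj]
  ext x
  simp [LatinSquare.rowPerm, LatinSquare.isotope, Equiv.Perm.inv_def, mul_inv_rev]

theorem isotope_colPerm {n : ℕ} (α β γ : Equiv.Perm (Fin n)) (L : LatinSquare n) (c : Fin n) :
    (LatinSquare.isotope α β γ L).colPerm c = α * L.colPerm (β⁻¹ c) * γ⁻¹ := by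
  rw [← inv_inj]
  ext x
  simp [LatinSquare.colPerm, LatinSquare.isotope, Equiv.Perm.inv_def, mul_inv_rev]

theorem isotope_par {n : ℕ} (hn : Odd n) (α β γ : Equiv.Perm (Fin n)) (L : LatinSquare n) :
    (LatinSquare.isotope α β γ L).par =
      Equiv.Perm.sign α * Equiv.Perm.sign β * L.par := by
  have hp : ∀ u : ℤˣ, u ^ n = u := fun u => by
    rcases Int.units_eq_one_or u with h | h <;> simp [h, hn.neg_one_pow]
  unfold LatinSquare.par
  simp only [isotope_rowPerm, isotope_colPerm, Equiv.Perm.sign_mul, Equiv.Perm.sign_inv,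
    Finset.prod_mul_distrib, Finset.prod_const, Finset.card_univ, Fintype.card_fin, hp]
  rw [Equiv.prod_comp α⁻¹ (fun r => Equiv.Perm.sign (L.rowPerm r)),
    Equiv.prod_comp β⁻¹ (fun r => Equiv.Perm.sign (L.colPerm r))]
  rcases Int.units_eq_one_or (Equiv.Perm.sign γ) with h | h <;> rw [h] <;> simp <;> ac_rfl

/-- for odd `n`, a reduced `L`, and
`Θ = (α, α∘π_j∘σ_{α⁻¹(1)}⁻¹, α∘π_j)`, we have
`par(Θ(L)) = sgn(σ_{α⁻¹(1)}) ⬝ sgn(π_j) ⬝ par(L)`. -/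
theorem stmt4 {n : ℕ} [NeZero n] (hn : Odd n) (L : LatinSquare n) (hL : L.Reduced)
    (α : Equiv.Perm (Fin n)) (j : Fin n) :
    (LatinSquare.isotope α (α * L.colPerm j * (L.rowPerm (α⁻¹ 0))⁻¹) (α * L.colPerm j) L).par =
      Equiv.Perm.sign (L.rowPerm (α⁻¹ 0)) * Equiv.Perm.sign (L.colPerm j) * L.par := by
  rw [isotope_par hn]
  simp only [Equiv.Perm.sign_mul, Equiv.Perm.sign_inv]
  rcases Int.units_eq_one_or (Equiv.Perm.sign α) with h | h <;> rw [h] <;> simp <;> ac_rfl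
end

section
/- If two Latin squares of order n are isotopic, then they have the same parity type; that is, the minimum of the number of even rows and the number of odd rows is the same for both squares, and likewise for columns. -/
open Equiv Finset

theorem min_card_aux {n : ℕ} (f g : Fin n → ℤˣ) (α : Equiv.Perm (Fin n)) (e : ℤˣ)
    (h : ∀ r, g (α r) = e * f r) :
    min (univ.filter fun r => f r = 1).card (univ.filter fun r => f r = -1).card =
    min (univ.filter fun r => g r = 1).card (univ.filter fun r => g r = -1).card := by
  have key : ∀ s : ℤˣ, (univ.filter fun r => f r = s).card =
      (univ.filter fun r => g r = e * s).card := by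
    intro s
    refine Finset.card_equiv α ?_
    intro r
    simp [h]
  rw [key, key]
  rcases Int.units_eq_one_or e with rfl | rfl
  · simp
  · simp [min_comm]

theorem rowPerm_isotope {n : ℕ} (α β γ : Equiv.Perm (Fin n)) (L : LatinSquare n) (r : Fin n) :
    (LatinSquare.isotope α β γ L).rowPerm (α r) = β * L.rowPerm r * γ⁻¹ := by
  rw [← inv_inj]
  ext c
  simp [LatinSquare.rowPerm, LatinSquare.isotope, Equiv.Perm.inv_def]

theorem colPerm_isotope {n : ℕ} (α β γ : Equiv.Perm (Fin n)) (L : LatinSquare n) (c : Fin n) :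
    (LatinSquare.isotope α β γ L).colPerm (β c) = α * L.colPerm c * γ⁻¹ := by
  rw [← inv_inj]
  ext r
  simp [LatinSquare.colPerm, LatinSquare.isotope, Equiv.Perm.inv_def]

/-- isotopic Latin squares have the same parity type. -/
theorem stmt5 {n : ℕ} (L L' : LatinSquare n) (h : LatinSquare.Isotopic L L') :
    L.parityType = L'.parityType := by
  obtain ⟨α, β, γ, rfl⟩ := h
  unfold LatinSquare.parityType
  refine Prod.ext ?_ ?_
  · refine min_card_aux _ _ α (Equiv.Perm.sign β * Equiv.Perm.sign γ) fun r => ?_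
    rw [rowPerm_isotope]
    simp [mul_right_comm]
  · refine min_card_aux _ _ β (Equiv.Perm.sign α * Equiv.Perm.sign γ) fun r => ?_
    rw [colPerm_isotope]
    simp [mul_right_comm]
end

section
/- Let n be odd and let N_n(k,m) denote the number of reduced Latin squares of order n with parity type (k,m), and let E_n(k,m) denote the number of even reduced Latin squares of order n with parity type (k,m). If k ≡ m (mod 2), then n² · E_n(k,m) = (km + (n−k)(n−m)) · N_n(k,m), and if k ≢ m (mod 2), then n² · E_n(k,m) = (k(n−m) + m(n−k)) · N_n(k,m). -/
open Equiv Finset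

namespace LatinSquare

variable {n : ℕ}

theorem aux_ext {L L' : LatinSquare n} (h : ∀ r c, L.entry r c = L'.entry r c) : L = L' := by
  cases L; cases L'
  simp only [LatinSquare.mk.injEq]
  funext r c
  exact h r c

theorem aux_row_inv (L : LatinSquare n) (r c : Fin n) : (L.rowPerm r)⁻¹ c = L.entry r c := rfl

theorem aux_col_inv (L : LatinSquare n) (r c : Fin n) : (L.colPerm c)⁻¹ r = L.entry r c := rfl

theorem aux_finite : Finite (LatinSquare n) :=
  Finite.of_injective (fun L : LatinSquare n => L.entry) (by
    intro L L' h
    exact aux_ext fun r c => congrFun (congrFun h r) c)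

theorem aux_isotope_row (α β γ : Equiv.Perm (Fin n)) (L : LatinSquare n) (x : Fin n) :
    (isotope α β γ L).rowPerm x = β * L.rowPerm (α⁻¹ x) * γ⁻¹ := by
  rw [← inv_inj]
  ext c
  rw [aux_row_inv]
  simp only [mul_inv_rev, inv_inv, Equiv.Perm.mul_apply, aux_row_inv]
  rfl

theorem aux_isotope_col (α β γ : Equiv.Perm (Fin n)) (L : LatinSquare n) (x : Fin n) :
    (isotope α β γ L).colPerm x = α * L.colPerm (β⁻¹ x) * γ⁻¹ := by
  rw [← inv_inj]
  ext c
  rw [aux_col_inv]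
  simp only [mul_inv_rev, inv_inv, Equiv.Perm.mul_apply, aux_col_inv]
  rfl

/-- The symbol permutation used for re-normalising. -/
def gam [NeZero n] (L : LatinSquare n) (r c : Fin n) : Equiv.Perm (Fin n) :=
  Equiv.swap (L.entry r c) 0

/-- Row permutation used for re-normalising. -/
noncomputable def alp [NeZero n] (L : LatinSquare n) (r c : Fin n) : Equiv.Perm (Fin n) :=
  L.gam r c * (L.colPerm c)⁻¹

/-- Column permutation used for re-normalising. -/
noncomputable def bet [NeZero n] (L : LatinSquare n) (r c : Fin n) : Equiv.Perm (Fin n) :=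
  L.gam r c * (L.rowPerm r)⁻¹

/-- Re-normalised square with row `r` and column `c` first. -/
noncomputable def tr [NeZero n] (L : LatinSquare n) (r c : Fin n) : LatinSquare n :=
  isotope (L.alp r c) (L.bet r c) (L.gam r c) L

theorem tr_reduced [NeZero n] (L : LatinSquare n) (r c : Fin n) : (L.tr r c).Reduced := by
  have ha : (L.alp r c)⁻¹ 0 = r := by
    rw [Equiv.Perm.inv_eq_iff_eq]
    rw [alp, Equiv.Perm.mul_apply, aux_col_inv, gam, Equiv.swap_apply_left]
  have hb : (L.bet r c)⁻¹ 0 = c := by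
    rw [Equiv.Perm.inv_eq_iff_eq]
    rw [bet, Equiv.Perm.mul_apply, aux_row_inv, gam, Equiv.swap_apply_left]
  constructor
  · rw [tr, aux_isotope_row, ha]; simp [bet]
  · rw [tr, aux_isotope_col, hb]; simp [alp]

theorem red_row [NeZero n] {L : LatinSquare n} (h : L.Reduced) (c : Fin n) :
    L.entry 0 c = c := by rw [← aux_row_inv, h.1]; simp

theorem red_col [NeZero n] {L : LatinSquare n} (h : L.Reduced) (r : Fin n) :
    L.entry r 0 = r := by rw [← aux_col_inv, h.2]; simp

theorem gam_sq [NeZero n] (L : LatinSquare n) (r c : Fin n) : L.gam r c * L.gam r c = 1 := by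
  simp [gam]

theorem gam_inv [NeZero n] (L : LatinSquare n) (r c : Fin n) : (L.gam r c)⁻¹ = L.gam r c := by
  simp [gam]

theorem tr_tr [NeZero n] {L : LatinSquare n} (h : L.Reduced) (r c : Fin n) :
    (L.tr r c).gam (L.gam r c c) (L.gam r c r) = L.gam r c ∧
    (L.tr r c).tr (L.gam r c c) (L.gam r c r) = L := by
  have ha : (L.alp r c)⁻¹ (L.gam r c c) = 0 := by
    rw [Equiv.Perm.inv_eq_iff_eq]
    rw [alp, Equiv.Perm.mul_apply, aux_col_inv, red_row h]
  have hb : (L.bet r c)⁻¹ (L.gam r c r) = 0 := by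
    rw [Equiv.Perm.inv_eq_iff_eq]
    rw [bet, Equiv.Perm.mul_apply, aux_row_inv, red_col h]
  have hg : (L.tr r c).gam (L.gam r c c) (L.gam r c r) = L.gam r c := by
    have : (L.tr r c).entry (L.gam r c c) (L.gam r c r) = L.entry r c := by
      simp only [tr, isotope, ha, hb, red_row h]
      simp [gam]
    rw [gam, this, gam]
  refine ⟨hg, ?_⟩
  have h1 : (L.tr r c).alp (L.gam r c c) (L.gam r c r) = (L.alp r c)⁻¹ := by
    rw [alp, hg, tr, aux_isotope_col, hb, h.2]
    simp [← mul_assoc, gam_sq]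
  have h2 : (L.tr r c).bet (L.gam r c c) (L.gam r c r) = (L.bet r c)⁻¹ := by
    rw [bet, hg, tr, aux_isotope_row, ha, h.1]
    simp [← mul_assoc, gam_sq]
  rw [tr, h1, h2, hg]
  apply aux_ext
  intro x y
  simp only [tr, isotope, inv_inv]
  rw [← Equiv.Perm.mul_apply, gam_sq, ← Equiv.Perm.mul_apply, ← Equiv.Perm.mul_apply,
    inv_mul_cancel, inv_mul_cancel]
  rfl

theorem tr_row_sign [NeZero n] (L : LatinSquare n) (r c x : Fin n) :
    Equiv.Perm.sign ((L.tr r c).rowPerm x) =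
      Equiv.Perm.sign (L.rowPerm r) * Equiv.Perm.sign (L.rowPerm ((L.alp r c)⁻¹ x)) := by
  rw [tr, aux_isotope_row]
  simp only [bet, Equiv.Perm.sign_mul, Equiv.Perm.sign_inv]
  rcases Int.units_eq_one_or (Equiv.Perm.sign (L.gam r c)) with h | h <;> simp [h]

theorem tr_col_sign [NeZero n] (L : LatinSquare n) (r c x : Fin n) :
    Equiv.Perm.sign ((L.tr r c).colPerm x) =
      Equiv.Perm.sign (L.colPerm c) * Equiv.Perm.sign (L.colPerm ((L.bet r c)⁻¹ x)) := by
  rw [tr, aux_isotope_col]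
  simp only [alp, Equiv.Perm.sign_mul, Equiv.Perm.sign_inv]
  rcases Int.units_eq_one_or (Equiv.Perm.sign (L.gam r c)) with h | h <;> simp [h]

theorem aux_card_perm (f : Fin n → ℤˣ) (e : Equiv.Perm (Fin n)) (v : ℤˣ) :
    (univ.filter fun x => f (e x) = v).card = (univ.filter fun x => f x = v).card :=
  Finset.card_bijective e e.bijective (by simp)

theorem aux_min (f : Fin n → ℤˣ) (e : Equiv.Perm (Fin n)) (u : ℤˣ) :
    min (univ.filter fun x => u * f (e x) = 1).card (univ.filter fun x => u * f (e x) = -1).card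
      = min (univ.filter fun x => f x = 1).card (univ.filter fun x => f x = -1).card := by
  rcases Int.units_eq_one_or u with h | h
  · subst h
    simp only [one_mul, aux_card_perm f e]
  · subst h
    simp only [neg_mul, one_mul, neg_eq_iff_eq_neg, neg_neg, aux_card_perm f e]
    rw [min_comm]

theorem aux_prod (hn : Odd n) (f : Fin n → ℤˣ) (e : Equiv.Perm (Fin n)) (u : ℤˣ) :
    ∏ x, (u * f (e x)) = u * ∏ x, f x := by
  rw [Finset.prod_mul_distrib, Equiv.prod_comp e f]
  rcases Int.units_eq_one_or u with h | h <;> simp [h, hn.neg_one_pow]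

theorem tr_type [NeZero n] (L : LatinSquare n) (r c : Fin n) :
    (L.tr r c).parityType = L.parityType := by
  simp only [parityType, tr_row_sign, tr_col_sign]
  rw [aux_min (fun x => Equiv.Perm.sign (L.rowPerm x)),
    aux_min (fun x => Equiv.Perm.sign (L.colPerm x))]

theorem tr_par [NeZero n] (hn : Odd n) (L : LatinSquare n) (r c : Fin n) :
    (L.tr r c).par =
      L.par * (Equiv.Perm.sign (L.rowPerm r) * Equiv.Perm.sign (L.colPerm c)) := by
  simp only [par, tr_row_sign, tr_col_sign]
  rw [aux_prod hn (fun x => Equiv.Perm.sign (L.rowPerm x)),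
    aux_prod hn (fun x => Equiv.Perm.sign (L.colPerm x))]
  rw [mul_mul_mul_comm, mul_comm]

theorem aux_prod_sign (f : Fin n → ℤˣ) :
    ∏ x, f x = (-1) ^ (univ.filter fun x => f x = -1).card := by
  rw [← Finset.prod_const, Finset.prod_filter]
  refine Finset.prod_congr rfl fun x _ => ?_
  rcases Int.units_eq_one_or (f x) with h | h <;> simp [h]

theorem aux_card_add (f : Fin n → ℤˣ) :
    (univ.filter fun x => f x = 1).card + (univ.filter fun x => f x = -1).card = n := by
  have h : (univ.filter fun x => f x = -1) = univ.filter fun x => ¬ f x = 1 := by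
    ext x
    rcases Int.units_eq_one_or (f x) with h | h <;> simp [h]
  rw [h, Finset.card_filter_add_card_filter_not]; simp

theorem aux_count (f g : Fin n → ℤˣ) (v : ℤˣ) :
    (univ.filter fun p : Fin n × Fin n => v * (f p.1 * g p.2) = 1).card =
      (univ.filter fun x => f x = 1).card * (univ.filter fun x => g x = v).card +
      (univ.filter fun x => f x = -1).card * (univ.filter fun x => g x = -v).card := by
  rw [← Finset.card_product, ← Finset.card_product, ← Finset.card_union_of_disjoint]
  · congr 1
    ext ⟨x, y⟩
    simp only [mem_filter, mem_univ, true_and, mem_union, mem_product]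
    generalize f x = a
    generalize g y = b
    revert a b v
    decide
  · rw [Finset.disjoint_left]
    rintro ⟨x, y⟩ h1 h2
    simp only [mem_filter, mem_univ, true_and, mem_product] at h1 h2
    rw [h1.1] at h2
    exact absurd h2.1 (by decide)

/-- The constant of the theorem. -/
def cst (n k m : ℕ) : ℕ :=
  if k % 2 = m % 2 then k * m + (n - k) * (n - m) else k * (n - m) + m * (n - k)

theorem aux_count_eq [NeZero n] (hn : Odd n) (L : LatinSquare n) (k m : ℕ)
    (hL : L.parityType = (k, m)) :
    (univ.filter fun p : Fin n × Fin n => (L.tr p.1 p.2).par = 1).card = cst n k m := by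
  simp only [tr_par hn]
  rw [aux_count (fun x => Equiv.Perm.sign (L.rowPerm x)) (fun x => Equiv.Perm.sign (L.colPerm x))]
  have hp : L.par = (-1) ^ ((univ.filter fun x => Equiv.Perm.sign (L.rowPerm x) = -1).card +
      (univ.filter fun x => Equiv.Perm.sign (L.colPerm x) = -1).card) := by
    rw [par, aux_prod_sign, aux_prod_sign, pow_add]
  have h1 := aux_card_add (fun x => Equiv.Perm.sign (L.rowPerm x))
  have h2 := aux_card_add (fun x => Equiv.Perm.sign (L.colPerm x))
  simp only [parityType, Prod.mk.injEq] at hL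
  obtain ⟨h3, h4⟩ := hL
  obtain ⟨t, ht⟩ := hn
  rcases Nat.even_or_odd ((univ.filter fun x => Equiv.Perm.sign (L.rowPerm x) = -1).card +
      (univ.filter fun x => Equiv.Perm.sign (L.colPerm x) = -1).card) with he | he
  all_goals
    rw [he.neg_one_pow] at hp
    rw [hp]
    try rw [neg_neg]
    clear hp
    revert h1 h2 h3 h4 he
    generalize (univ.filter fun x => Equiv.Perm.sign (L.rowPerm x) = -1).card = a
    generalize (univ.filter fun x => Equiv.Perm.sign (L.colPerm x) = -1).card = b
    generalize (univ.filter fun x => Equiv.Perm.sign (L.rowPerm x) = 1).card = a'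
    generalize (univ.filter fun x => Equiv.Perm.sign (L.colPerm x) = 1).card = b'
    intro h1 h2 h3 h4 he
    have hb : b' = n - b := by omega
    have ha : a' = n - a := by omega
    have hk : (k = a ∧ n - k = a') ∨ (k = a' ∧ n - k = a) := by omega
    have hm : (m = b ∧ n - m = b') ∨ (m = b' ∧ n - m = b) := by omega
    unfold cst
    first | rw [Nat.even_iff] at he | rw [Nat.odd_iff] at he
    rcases hk with ⟨hk, hk'⟩ | ⟨hk, hk'⟩ <;> rcases hm with ⟨hm, hm'⟩ | ⟨hm, hm'⟩ <;>
      rw [hk', hm'] <;> subst hk <;> subst hm <;> split_ifs <;> first | (exfalso; omega) | ring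

theorem main_count [NeZero n] (hn : Odd n) (k m : ℕ) :
    n ^ 2 * Nat.card {L : LatinSquare n // L.Reduced ∧ L.parityType = (k, m) ∧ L.par = 1} =
      cst n k m * Nat.card {L : LatinSquare n // L.Reduced ∧ L.parityType = (k, m)} := by
  classical
  haveI : Finite (LatinSquare n) := aux_finite
  let e : {L : LatinSquare n // L.Reduced ∧ L.parityType = (k, m) ∧ L.par = 1} × (Fin n × Fin n) ≃
      (Σ L : {L : LatinSquare n // L.Reduced ∧ L.parityType = (k, m)},
        {p : Fin n × Fin n // (L.1.tr p.1 p.2).par = 1}) :=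
    { toFun := fun x => ⟨⟨x.1.1.tr x.2.1 x.2.2, tr_reduced _ _ _, by rw [tr_type]; exact x.1.2.2.1⟩,
        ⟨(x.1.1.gam x.2.1 x.2.2 x.2.2, x.1.1.gam x.2.1 x.2.2 x.2.1), by
          simp only
          rw [(tr_tr x.1.2.1 _ _).2]; exact x.1.2.2.2⟩⟩
      invFun := fun y => ⟨⟨y.1.1.tr y.2.1.1 y.2.1.2, tr_reduced _ _ _,
          by rw [tr_type]; exact y.1.2.2, y.2.2⟩,
        (y.1.1.gam y.2.1.1 y.2.1.2 y.2.1.2, y.1.1.gam y.2.1.1 y.2.1.2 y.2.1.1)⟩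
      left_inv := by
        rintro ⟨⟨L, h1, h2, h3⟩, r, c⟩
        have h := tr_tr h1 r c
        have hs : ∀ z, L.gam r c (L.gam r c z) = z := fun z => by
          rw [← Equiv.Perm.mul_apply, gam_sq]; rfl
        simp only [Prod.mk.injEq, Subtype.mk.injEq]
        refine ⟨h.2, ?_, ?_⟩ <;> rw [h.1, hs]
      right_inv := by
        rintro ⟨⟨L, h1, h2⟩, ⟨⟨r, c⟩, h3⟩⟩
        have h := tr_tr h1 r c
        have hs : ∀ z, L.gam r c (L.gam r c z) = z := fun z => by
          rw [← Equiv.Perm.mul_apply, gam_sq]; rfl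
        have key : ∀ (L' : {L : LatinSquare n // L.Reduced ∧ L.parityType = (k, m)})
            (p : Fin n × Fin n) (hp : (L'.1.tr p.1 p.2).par = 1)
            (hL : L'.1 = L) (hpp : p = (r, c)),
            (⟨L', ⟨p, hp⟩⟩ : (Σ L : {L : LatinSquare n // L.Reduced ∧ L.parityType = (k, m)},
              {p : Fin n × Fin n // (L.1.tr p.1 p.2).par = 1})) =
              ⟨⟨L, h1, h2⟩, ⟨(r, c), h3⟩⟩ := by
          rintro ⟨L', h'⟩ p hp hL hpp
          simp only at hL
          subst hL
          subst hpp
          rfl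
        apply key
        · exact h.2
        · simp only [Prod.mk.injEq]
          refine ⟨?_, ?_⟩ <;> rw [h.1, hs] }
  have hc := Nat.card_congr e
  haveI := Fintype.ofFinite {L : LatinSquare n // L.Reduced ∧ L.parityType = (k, m)}
  rw [Nat.card_prod, Nat.card_sigma] at hc
  have hi : ∀ L : {L : LatinSquare n // L.Reduced ∧ L.parityType = (k, m)},
      Nat.card {p : Fin n × Fin n // (L.1.tr p.1 p.2).par = 1} = cst n k m := by
    intro L
    rw [← aux_count_eq hn L.1 k m L.2.2, Nat.card_eq_fintype_card, Fintype.card_subtype]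
  simp only [hi, Finset.sum_const, Finset.card_univ, smul_eq_mul, Nat.card_prod, Nat.card_fin] at hc
  rw [← Nat.card_eq_fintype_card] at hc
  rw [pow_two, mul_comm, hc, mul_comm]

end LatinSquare

/-- for odd `n`, with `N_n(k,m)` the number of reduced Latin squares of
order `n` of parity type `(k,m)` and `E_n(k,m)` the number of even ones among them:
`n² E_n(k,m) = (km + (n−k)(n−m)) N_n(k,m)` when `k ≡ m (mod 2)`, and
`n² E_n(k,m) = (k(n−m) + m(n−k)) N_n(k,m)` otherwise. -/
theorem stmt7 {n : ℕ} [NeZero n] (hn : Odd n) (k m : ℕ) :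
    (k % 2 = m % 2 →
      n ^ 2 * Nat.card {L : LatinSquare n //
          L.Reduced ∧ L.parityType = (k, m) ∧ L.par = 1} =
        (k * m + (n - k) * (n - m)) *
          Nat.card {L : LatinSquare n // L.Reduced ∧ L.parityType = (k, m)}) ∧
    (k % 2 ≠ m % 2 →
      n ^ 2 * Nat.card {L : LatinSquare n //
          L.Reduced ∧ L.parityType = (k, m) ∧ L.par = 1} =
        (k * (n - m) + m * (n - k)) *
          Nat.card {L : LatinSquare n // L.Reduced ∧ L.parityType = (k, m)}) := by
  refine ⟨fun h => ?_, fun h => ?_⟩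
  · rw [LatinSquare.main_count hn k m, LatinSquare.cst, if_pos h]
  · rw [LatinSquare.main_count hn k m, LatinSquare.cst, if_neg h]
end

section
/- Let p > 2 be a prime and let L be a Latin square of order p with parity type (k,m). If k and m are both nonzero, then p does not divide |𝔄(L)|, the order of the autotopy group of L. -/
open Equiv Finset

lemma aux_sign {p : ℕ} (hp : p.Prime) (hp2 : 2 < p) (b : Equiv.Perm (Fin p)) (hb : b ^ p = 1) :
    Equiv.Perm.sign b = 1 := by
  have h1 : (Equiv.Perm.sign b) ^ p = 1 := by rw [← map_pow, hb, map_one]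
  have h2 : p % 2 = 1 := (hp.eq_two_or_odd).resolve_left (by omega)
  rw [Int.units_pow_eq_pow_mod_two, h2, pow_one] at h1
  exact h1

lemma aux_const {p : ℕ} (hp : p.Prime) (a : Equiv.Perm (Fin p)) (ha : a ^ p = 1) (ha1 : a ≠ 1)
    (f : Fin p → ℤˣ) (hf : ∀ x, f (a x) = f x) (x y : Fin p) : f x = f y := by
  have : Fact p.Prime := ⟨hp⟩
  have ho : orderOf a = p := orderOf_eq_prime ha ha1
  have hc : a.IsCycle := Equiv.Perm.isCycle_of_prime_order'' (by simpa using hp) (by simpa using ho)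
  have hs : a.support = univ := by
    apply Finset.eq_univ_of_card
    rw [← hc.orderOf, ho, Fintype.card_fin]
  have hm : ∀ z, a z ≠ z := fun z => by
    rw [← Equiv.Perm.mem_support, hs]; exact mem_univ z
  obtain ⟨i, -, -, hi⟩ := (hc.sameCycle (hm x) (hm y)).exists_pow_eq
  have key : ∀ i : ℕ, f ((a ^ i) x) = f x := by
    intro i
    induction i with
    | zero => simp
    | succ k ih => rw [pow_succ', Equiv.Perm.mul_apply, hf, ih]
  rw [← hi, key]

lemma aux_min {p : ℕ} (f : Fin p → ℤˣ) (hf : ∀ x y, f x = f y) :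
    min (univ.filter fun r => f r = 1).card (univ.filter fun r => f r = -1).card = 0 := by
  by_contra hne
  have h1 : (univ.filter fun r => f r = 1).card ≠ 0 := by omega
  have h2 : (univ.filter fun r => f r = -1).card ≠ 0 := by omega
  obtain ⟨x, hx⟩ := Finset.card_ne_zero.mp h1
  obtain ⟨y, hy⟩ := Finset.card_ne_zero.mp h2
  have hx' := (Finset.mem_filter.mp hx).2
  have hy' := (Finset.mem_filter.mp hy).2
  have := hf x y
  rw [hx', hy'] at this
  exact absurd this (by decide)

lemma aux_iso {n : ℕ} (L : LatinSquare n) (a b g : Equiv.Perm (Fin n)) :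
    LatinSquare.isotope a b g L = L ↔ ∀ r c, L.entry (a r) (b c) = g (L.entry r c) := by
  constructor
  · intro h r c
    have := congrArg (fun M => LatinSquare.entry M (a r) (b c)) h
    simpa [LatinSquare.isotope] using this.symm
  · intro h
    have he : (LatinSquare.isotope a b g L).entry = L.entry := by
      funext r c
      have := h (a⁻¹ r) (b⁻¹ c)
      simpa [LatinSquare.isotope] using this.symm
    cases L
    simp only [LatinSquare.isotope] at he ⊢
    congr

/-- The autotopy group as a subgroup. -/
def autGrp {n : ℕ} (L : LatinSquare n) :
    Subgroup (Equiv.Perm (Fin n) × Equiv.Perm (Fin n) × Equiv.Perm (Fin n)) where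
  carrier := {Θ | LatinSquare.isotope Θ.1 Θ.2.1 Θ.2.2 L = L}
  one_mem' := by
    rw [Set.mem_ofPred_eq, aux_iso]; simp
  mul_mem' := by
    intro x y hx hy
    rw [Set.mem_ofPred_eq, aux_iso] at *
    intro r c
    simp [hx, hy]
  inv_mem' := by
    intro x hx
    rw [Set.mem_ofPred_eq, aux_iso] at *
    intro r c
    have := hx (x.1⁻¹ r) (x.2.1⁻¹ c)
    simp at this
    simp [this]

theorem stmt12 (p : ℕ) (hp : p.Prime) (hp2 : 2 < p) (L : LatinSquare p)
    (k m : ℕ) (h : L.parityType = (k, m)) (hk : k ≠ 0) (hm : m ≠ 0) :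
    ¬ p ∣ autotopyCard L := by
  intro hd
  have : Fact p.Prime := ⟨hp⟩
  have hd' : p ∣ Nat.card (autGrp L) := hd
  obtain ⟨⟨⟨a, b, g⟩, hx⟩, ho⟩ := exists_prime_orderOf_dvd_card' p hd'
  have hiso := (aux_iso L a b g).1 hx
  have hpow := pow_orderOf_eq_one (⟨(a, b, g), hx⟩ : autGrp L)
  rw [ho, Subtype.ext_iff] at hpow
  simp only [Subgroup.coe_pow, Subgroup.coe_one, Prod.pow_mk, Prod.mk_eq_one] at hpow
  obtain ⟨hap, hbp, hgp⟩ := hpow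
  have hsa := aux_sign hp hp2 a hap
  have hsb := aux_sign hp hp2 b hbp
  have hsg := aux_sign hp hp2 g hgp
  rw [LatinSquare.parityType, Prod.mk.injEq] at h
  have ha : a = 1 := by
    by_contra hne
    apply hk
    rw [← h.1]
    apply aux_min (fun r => Equiv.Perm.sign (L.rowPerm r))
    apply aux_const hp a hap hne
    intro r
    have : L.rowPerm (a r) = b * L.rowPerm r * g⁻¹ := by
      rw [← inv_inj]
      ext1 c
      have := hiso r (b⁻¹ c)
      simpa [LatinSquare.rowPerm, Equiv.Perm.inv_def] using this
    simp [this, hsb, hsg]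
  have hb : b = 1 := by
    by_contra hne
    apply hm
    rw [← h.2]
    apply aux_min (fun r => Equiv.Perm.sign (L.colPerm r))
    apply aux_const hp b hbp hne
    intro c
    have : L.colPerm (b c) = a * L.colPerm c * g⁻¹ := by
      rw [← inv_inj]
      ext1 r
      have := hiso (a⁻¹ r) c
      simpa [LatinSquare.colPerm, Equiv.Perm.inv_def] using this
    simp [this, hsa, hsg]
  subst ha hb
  have hg : g = 1 := by
    ext1 s
    obtain ⟨c, hc⟩ := (L.row_bij ⟨0, hp.pos⟩).2 s
    have := hiso ⟨0, hp.pos⟩ c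
    simp only [Equiv.Perm.one_apply] at this hc ⊢
    rw [← hc, ← this]
  subst hg
  have h1 : (⟨(1, 1, 1), hx⟩ : autGrp L) = 1 := rfl
  rw [h1, orderOf_one] at ho
  omega
end

section
/- Let p > 2 be a prime and let L be a Latin square of order p with parity type (k,m). If k ≠ 0 or m ≠ 0, then p² does not divide |𝔄(L)|, the order of the autotopy group of L. -/
open Equiv Finset

theorem not_sq_dvd_fact (p : ℕ) (hp : p.Prime) : ¬ p ^ 2 ∣ p.factorial := by
  intro h
  obtain ⟨q, rfl⟩ : ∃ q, p = q + 1 := ⟨p - 1, by have := hp.pos; omega⟩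
  rw [Nat.factorial_succ, pow_two] at h
  have h2 := Nat.dvd_of_mul_dvd_mul_left (Nat.succ_pos q) h
  have := (hp.dvd_factorial).1 h2
  omega

theorem core_const {p : ℕ} (hp : p.Prime) {P : Type*} [Group P] (hP : Nat.card P = p ^ 2)
    (f g : P →* Equiv.Perm (Fin p)) (hinj : ∀ x, f x = 1 → g x = 1 → x = 1)
    (s : Fin p → ℤˣ) (hs : ∀ x r, s (f x r) = s r) : ∀ r r', s r = s r' := by
  have hcard : Nat.card (Equiv.Perm (Fin p)) = p.factorial := by
    rw [Nat.card_eq_fintype_card, Fintype.card_perm, Fintype.card_fin]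
  obtain ⟨x, hx⟩ : ∃ x, f x ≠ 1 := by
    by_contra! hcon
    have hg : Function.Injective g := (injective_iff_map_eq_one g).2 fun x h => hinj x (hcon x) h
    have := Subgroup.card_dvd_of_injective g hg
    rw [hP, hcard] at this
    exact not_sq_dvd_fact p hp this
  have hpow : f x ^ (p ^ 2) = 1 := by
    rw [← map_pow, ← hP, pow_card_eq_one', map_one]
  have hord : orderOf (f x) = p := by
    obtain ⟨j, hj, hj'⟩ := (Nat.dvd_prime_pow hp).1 (orderOf_dvd_of_pow_eq_one hpow)
    have hd : orderOf (f x) ∣ p.factorial := hcard ▸ orderOf_dvd_natCard (f x)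
    interval_cases j
    · exact absurd (orderOf_eq_one_iff.1 (by simpa using hj')) hx
    · simpa using hj'
    · rw [hj'] at hd
      exact absurd hd (not_sq_dvd_fact p hp)
  have hc : (f x).IsCycle := Equiv.Perm.isCycle_of_prime_order''
    (by simpa using hp) (by simpa using hord)
  have hsupp : (f x).support = Finset.univ := by
    rw [← Finset.card_eq_iff_eq_univ, ← hc.orderOf, hord, Fintype.card_fin]
  have hne : ∀ r, f x r ≠ r := fun r => Equiv.Perm.mem_support.1 (hsupp ▸ Finset.mem_univ r)
  intro r r'
  obtain ⟨i, hi⟩ := hc.exists_pow_eq (hne r) (hne r')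
  rw [← hi, ← map_pow, hs]

namespace LatinSquare

theorem isotope_iff {n : ℕ} (L : LatinSquare n) (α β γ : Equiv.Perm (Fin n)) :
    isotope α β γ L = L ↔ ∀ r c, L.entry (α r) (β c) = γ (L.entry r c) := by
  constructor
  · intro h r c
    have := congrArg (fun M => LatinSquare.entry M (α r) (β c)) h
    simpa [isotope] using this.symm
  · intro h
    have : (isotope α β γ L).entry = L.entry := by
      funext r c
      have := h (α⁻¹ r) (β⁻¹ c)
      simpa [isotope] using this.symm
    cases L
    simpa [isotope] using this

/-- The autotopy group as a subgroup. -/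
def autGrp {n : ℕ} (L : LatinSquare n) :
    Subgroup (Equiv.Perm (Fin n) × Equiv.Perm (Fin n) × Equiv.Perm (Fin n)) where
  carrier := {Θ | ∀ r c, L.entry (Θ.1 r) (Θ.2.1 c) = Θ.2.2 (L.entry r c)}
  mul_mem' := by
    intro a b ha hb r c
    simp only [Set.mem_ofPred_eq] at ha hb
    simp [ha, hb]
  one_mem' := by intro r c; simp
  inv_mem' := by
    intro a ha r c
    have := ha (a.1⁻¹ r) (a.2.1⁻¹ c)
    change L.entry (a.1⁻¹ r) (a.2.1⁻¹ c) = a.2.2⁻¹ (L.entry r c)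
    rw [Equiv.Perm.eq_inv_iff_eq, ← this]; simp

theorem rowPerm_eq {n : ℕ} (L : LatinSquare n) (α β γ : Equiv.Perm (Fin n))
    (h : ∀ r c, L.entry (α r) (β c) = γ (L.entry r c)) (r : Fin n) :
    L.rowPerm (α r) = β * L.rowPerm r * γ⁻¹ := by
  apply Equiv.ext
  intro i
  have e : L.entry r (L.rowPerm r (γ⁻¹ i)) = γ⁻¹ i :=
    (Equiv.ofBijective _ (L.row_bij r)).apply_symm_apply _
  apply (Equiv.symm_apply_eq _).2
  change i = L.entry (α r) (β (L.rowPerm r (γ⁻¹ i)))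
  rw [h, e]; simp

theorem colPerm_eq {n : ℕ} (L : LatinSquare n) (α β γ : Equiv.Perm (Fin n))
    (h : ∀ r c, L.entry (α r) (β c) = γ (L.entry r c)) (c : Fin n) :
    L.colPerm (β c) = α * L.colPerm c * γ⁻¹ := by
  apply Equiv.ext
  intro i
  have e : L.entry (L.colPerm c (γ⁻¹ i)) c = γ⁻¹ i :=
    (Equiv.ofBijective _ (L.col_bij c)).apply_symm_apply _
  apply (Equiv.symm_apply_eq _).2
  change i = L.entry (α (L.colPerm c (γ⁻¹ i))) (β c)
  rw [h, e]; simp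

end LatinSquare

theorem min_const {p : ℕ} (s : Fin p → ℤˣ) (hs : ∀ r r', s r = s r') :
    min (univ.filter fun r => s r = 1).card (univ.filter fun r => s r = -1).card = 0 := by
  by_contra hne
  have h1 : 0 < (univ.filter fun r => s r = 1).card := by omega
  have h2 : 0 < (univ.filter fun r => s r = -1).card := by omega
  obtain ⟨a, ha⟩ := Finset.card_pos.1 h1
  obtain ⟨b, hb⟩ := Finset.card_pos.1 h2
  have ha := (Finset.mem_filter.1 ha).2
  have hb := (Finset.mem_filter.1 hb).2
  rw [hs b a, ha] at hb
  exact absurd hb (by decide)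

/-- if `p > 2` is prime and `L` is a Latin square of order `p` with
parity type `(k,m)` where `k ≠ 0` or `m ≠ 0`, then `p² ∤ |𝔄(L)|`. -/
theorem stmt13 (p : ℕ) (hp : p.Prime) (hp2 : 2 < p) (L : LatinSquare p)
    (k m : ℕ) (h : L.parityType = (k, m)) (hkm : k ≠ 0 ∨ m ≠ 0) :
    ¬ p ^ 2 ∣ autotopyCard L := by
  intro hdvd
  haveI : Fact p.Prime := ⟨hp⟩
  have hcard : autotopyCard L = Nat.card L.autGrp :=
    Nat.card_congr (Equiv.subtypeEquivRight fun Θ => L.isotope_iff Θ.1 Θ.2.1 Θ.2.2)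
  rw [hcard] at hdvd
  obtain ⟨P, hP⟩ := Sylow.exists_subgroup_card_pow_prime p hdvd
  have hodd : Odd (p ^ 2) := (hp.odd_of_ne_two (by omega)).pow
  let ι : P →* (Equiv.Perm (Fin p) × Equiv.Perm (Fin p) × Equiv.Perm (Fin p)) :=
    L.autGrp.subtype.comp P.subtype
  have hι : Function.Injective ι := fun x y hxy => Subtype.ext (Subtype.ext hxy)
  let f : P →* Equiv.Perm (Fin p) := (MonoidHom.fst _ _).comp ι
  let g : P →* Equiv.Perm (Fin p) := ((MonoidHom.fst _ _).comp (MonoidHom.snd _ _)).comp ι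
  let e : P →* Equiv.Perm (Fin p) := ((MonoidHom.snd _ _).comp (MonoidHom.snd _ _)).comp ι
  have hrel : ∀ x r c, L.entry (f x r) (g x c) = e x (L.entry r c) := fun x => x.1.2
  have hsign : ∀ (q : P →* Equiv.Perm (Fin p)) x, Equiv.Perm.sign (q x) = 1 := by
    intro q x
    have h1 : Equiv.Perm.sign (q x) ^ (p ^ 2) = 1 := by
      rw [← map_pow, ← map_pow, ← hP, pow_card_eq_one', map_one, map_one]
    rcases Int.units_eq_one_or (Equiv.Perm.sign (q x)) with h2 | h2
    · exact h2
    · rw [h2, hodd.neg_one_pow] at h1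
      exact absurd h1 (by decide)
  have hinj : ∀ x, f x = 1 → g x = 1 → x = 1 := by
    intro x hf hg
    have he : e x = 1 := by
      apply Equiv.ext
      intro i
      obtain ⟨c, hc⟩ := (L.row_bij i).2 i
      have := hrel x i c
      simp only [hf, hg, Equiv.Perm.one_apply] at this
      have hc : L.entry i c = i := hc
      rw [hc] at this
      exact this.symm
    apply hι
    rw [map_one]
    exact Prod.ext hf (Prod.ext hg he)
  have hr := core_const hp hP f g hinj (fun r => Equiv.Perm.sign (L.rowPerm r)) (by
    intro x r
    simp only [L.rowPerm_eq _ _ _ (hrel x) r, map_mul, map_inv, hsign g, hsign e]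
    simp)
  have hc := core_const hp hP g f (fun x a b => hinj x b a)
    (fun c => Equiv.Perm.sign (L.colPerm c)) (by
    intro x c
    simp only [L.colPerm_eq _ _ _ (hrel x) c, map_mul, map_inv, hsign f, hsign e]
    simp)
  have hk : k = 0 := by
    rw [← min_const _ hr]; exact (congrArg Prod.fst h).symm
  have hm : m = 0 := by
    rw [← min_const _ hc]; exact (congrArg Prod.snd h).symm
  rcases hkm with h | h
  · exact h hk
  · exact h hm
end

section
/- Let L be a reduced Latin square of order n with columns π_1,…,π_n (viewed as permutations). If Φ = (1, β, γ) is an autotopism of L whose first component is the identity permutation, then γ = β and β⁻¹ = π_r, where r = β(1); in particular, β⁻¹ is a column of L. -/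
open Equiv Finset

/-- if `Φ = (1, β, γ)` is an autotopism of a reduced Latin square `L`
whose first component is the identity, then `γ = β` and `β⁻¹` equals the column
`π_r` of `L`, where `r = β(1)` (first index). -/
theorem stmt16 {n : ℕ} [NeZero n] (L : LatinSquare n) (hL : L.Reduced)
    (β γ : Equiv.Perm (Fin n)) (h : LatinSquare.isotope 1 β γ L = L) :
    γ = β ∧ β⁻¹ = L.colPerm (β 0) := by
  have key : ∀ r c, γ (L.entry r c) = L.entry r (β c) := by
    intro r c
    have h1 := congrArg (fun M : LatinSquare n => M.entry r (β c)) h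
    simpa [LatinSquare.isotope] using h1
  have hrow : ∀ c, L.entry 0 c = c := by
    intro c
    have h1 := congrArg (fun p : Equiv.Perm (Fin n) => p.symm c) hL.1
    exact h1
  have hcol : ∀ r, L.entry r 0 = r := by
    intro r
    have h1 := congrArg (fun p : Equiv.Perm (Fin n) => p.symm r) hL.2
    exact h1
  have hg : γ = β := by
    ext c
    have h1 := key 0 c
    rw [hrow, hrow] at h1
    rw [h1]
  refine ⟨hg, ?_⟩
  subst hg
  have h2 : γ = Equiv.ofBijective _ (L.col_bij (γ 0)) := by
    apply Equiv.ext
    intro r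
    have h1 := key r 0
    rw [hcol] at h1
    exact h1
  exact congrArg Equiv.symm h2
end

section
/- Let L be a reduced Latin square of order n with rows σ_1,…,σ_n (viewed as permutations), and let Θ = (α, β, γ) be an autotopism of L. Then for each i ∈ [n], the permutation σ_{α⁻¹(1)}⁻¹ ∘ σ_{α⁻¹(i)} is conjugate in S_n to σ_i (in particular they have the same cycle structure); indeed σ_i = γ ∘ (σ_{α⁻¹(1)}⁻¹ ∘ σ_{α⁻¹(i)}) ∘ γ⁻¹. -/
open Equiv Finset

/-- if `Θ = (α, β, γ)` is an autotopism of a reduced Latin square `L`,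
then for each `i`, `σ_{α⁻¹(1)}⁻¹ ∘ σ_{α⁻¹(i)}` is conjugate in `S_n` to `σ_i`;
indeed `σ_i = γ ∘ (σ_{α⁻¹(1)}⁻¹ ∘ σ_{α⁻¹(i)}) ∘ γ⁻¹`. -/
theorem stmt17 {n : ℕ} [NeZero n] (L : LatinSquare n) (hL : L.Reduced)
    (α β γ : Equiv.Perm (Fin n)) (h : LatinSquare.isotope α β γ L = L) (i : Fin n) :
    IsConj ((L.rowPerm (α⁻¹ 0))⁻¹ * L.rowPerm (α⁻¹ i)) (L.rowPerm i) ∧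
      L.rowPerm i = γ * ((L.rowPerm (α⁻¹ 0))⁻¹ * L.rowPerm (α⁻¹ i)) * γ⁻¹ := by
  have key : ∀ r, L.rowPerm r = β * L.rowPerm (α⁻¹ r) * γ⁻¹ := by
    intro r
    have he : ∀ c, L.entry r c = γ (L.entry (α⁻¹ r) (β⁻¹ c)) := by
      intro c
      have := congrArg (fun M => LatinSquare.entry M r c) h
      exact this.symm
    apply inv_injective
    ext c
    have h1 : ∀ r c, (L.rowPerm r)⁻¹ c = L.entry r c := fun _ _ => rfl
    simp only [mul_inv_rev, inv_inv, Equiv.Perm.mul_apply, h1, he c]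
  have h0 := key 0
  rw [hL.1] at h0
  have hβ : β = γ * (L.rowPerm (α⁻¹ 0))⁻¹ := by
    have h2 : β * L.rowPerm (α⁻¹ 0) = γ := (mul_inv_eq_one.mp h0.symm)
    exact eq_mul_inv_of_mul_eq h2
  have main : L.rowPerm i = γ * ((L.rowPerm (α⁻¹ 0))⁻¹ * L.rowPerm (α⁻¹ i)) * γ⁻¹ := by
    have := key i
    rw [hβ] at this
    rw [← mul_assoc γ]
    exact this
  exact ⟨isConj_iff.mpr ⟨γ, main.symm⟩, main⟩
end
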